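/- arXiv:1907.09403 — 3 statements merged into one kernel-verified Lean document; each statement's English description precedes it below -/
import Mathlib

section
/- Let u ∈ C²(B₁) be a stable solution of −Δu = f(u) in B₁ ⊂ ℝⁿ, with f : ℝ → ℝ locally Lipschitz. Then for every Lipschitz function η with compact support in B₁ one has ∫_{B₁} 𝒜² η² dx ≤ ∫_{B₁} |∇u|² |∇η|² dx, where 𝒜 is defined by 𝒜² := Σ_{i,j} (∂_{ij}u)² − Σ_i ( Σ_j ∂_{ij}u ∂_j u / |∇u| )² at points where ∇u ≠ 0, and 𝒜 := 0 at points where ∇u = 0. -/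
open MeasureTheory Metric Filter Set
open scoped ENNReal NNReal

noncomputable section

/-- Euclidean space `ℝⁿ`. -/
abbrev Euc (n : ℕ) := EuclideanSpace ℝ (Fin n)

/-- The `i`-th standard basis vector of `ℝⁿ`. -/
def stdBasis (n : ℕ) (i : Fin n) : Euc n := EuclideanSpace.single i 1

/-- The Laplacian `Δu(x) = ∑ᵢ ∂ᵢᵢ u (x)`. -/
def lapl {n : ℕ} (u : Euc n → ℝ) (x : Euc n) : ℝ :=
  ∑ i, iteratedFDeriv ℝ 2 u x ![stdBasis n i, stdBasis n i]

/-- `f'_-(t) := liminf_{h → 0} (f(t+h) - f(t))/h`. -/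
def lowerDeriv (f : ℝ → ℝ) (t : ℝ) : ℝ :=
  Filter.liminf (fun h : ℝ => (f (t + h) - f t) / h) (nhdsWithin 0 {(0 : ℝ)}ᶜ)

/-- `u` is a stable solution of `−Δu = f(u)` in the open set `U`: the equation holds on `U`
and `∫_U f'_-(u) ξ² ≤ ∫_U |∇ξ|²` for every `ξ ∈ C^∞_c(U)`. -/
def IsStableIn {n : ℕ} (f : ℝ → ℝ) (u : Euc n → ℝ) (U : Set (Euc n)) : Prop :=
  (∀ x ∈ U, lapl u x = - f (u x)) ∧
  ∀ ξ : Euc n → ℝ, ContDiff ℝ (⊤ : ℕ∞) ξ → HasCompactSupport ξ → tsupport ξ ⊆ U →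
    (∫ x in U, lowerDeriv f (u x) * ξ x ^ 2) ≤ ∫ x in U, ‖gradient ξ x‖ ^ 2

/-- The last coordinate `xₙ` of a point of `ℝⁿ`. -/
def lastCoord (n : ℕ) (x : Euc n) : ℝ := if h : 0 < n then x ⟨n - 1, by omega⟩ else 0

/-- `Ω` is a `ϑ`-deformation of the half-ball `B₂⁺ = B₂ ∩ {xₙ > 0}`:
`Ω = Φ(B₂ ∩ {xₙ > 0})` for some `Φ ∈ C³(B₂; ℝⁿ)` with `Φ(0) = 0`, `DΦ(0) = Id` and
`‖D²Φ‖_{L^∞(B₂)} + ‖D³Φ‖_{L^∞(B₂)} ≤ ϑ`. -/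
def IsDeformedHalfBall {n : ℕ} (ϑ : ℝ) (Ω : Set (Euc n)) : Prop :=
  ∃ Φ : Euc n → Euc n, ContDiffOn ℝ 3 Φ (ball 0 2) ∧ Φ 0 = 0 ∧
    fderiv ℝ Φ 0 = ContinuousLinearMap.id ℝ (Euc n) ∧
    (∃ a b : ℝ, (∀ x ∈ ball (0 : Euc n) 2, ‖iteratedFDeriv ℝ 2 Φ x‖ ≤ a) ∧
      (∀ x ∈ ball (0 : Euc n) 2, ‖iteratedFDeriv ℝ 3 Φ x‖ ≤ b) ∧ a + b ≤ ϑ) ∧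
    Ω = Φ '' (ball 0 2 ∩ {x | 0 < lastCoord n x})

/-- `Ω` has boundary of class `C^k`, expressed through a global `C^k` defining function
which is nondegenerate on the boundary. -/
def HasCkBoundary {n : ℕ} (k : ℕ) (Ω : Set (Euc n)) : Prop :=
  ∃ φ : Euc n → ℝ, ContDiff ℝ (k : ℕ∞) φ ∧ Ω = {x | φ x < 0} ∧
    frontier Ω = {x | φ x = 0} ∧ ∀ x ∈ frontier Ω, fderiv ℝ φ x ≠ 0

/-- The Morrey norm bound `‖w‖_{M^{p,β}(A)} ≤ K`, i.e.
`r^{β−n} ∫_{A ∩ B_r(y)} |w|^p ≤ K^p` for all `y ∈ cl A` and `r > 0`. -/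
def MorreyBound {n : ℕ} (p β : ℝ) (A : Set (Euc n)) (w : Euc n → ℝ) (K : ℝ) : Prop :=
  ∀ y ∈ closure A, ∀ r : ℝ, 0 < r →
    r ^ (β - (n : ℝ)) * (∫ x in A ∩ ball y r, |w x| ^ p) ≤ K ^ p

open Classical in
/-- The quantity `𝒜²`: at points where `∇u ≠ 0`,
`𝒜² = Σ_{i,j} u_{ij}² − Σ_i (Σ_j u_{ij} u_j / |∇u|)²`, and `0` where `∇u = 0`. -/
def Asq {n : ℕ} (u : Euc n → ℝ) (x : Euc n) : ℝ :=
  if fderiv ℝ u x = 0 then 0 else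
    (∑ i, ∑ j, (iteratedFDeriv ℝ 2 u x ![stdBasis n i, stdBasis n j]) ^ 2)
      - ∑ i, (∑ j, iteratedFDeriv ℝ 2 u x ![stdBasis n i, stdBasis n j]
            * fderiv ℝ u x (stdBasis n j) / ‖gradient u x‖) ^ 2


open scoped Topology Convolution

section LowerDerivative

variable {f : ℝ → ℝ} {L : ℝ≥0}

theorem LipschitzWith.abs_slope_le (hf : LipschitzWith L f) (t h : ℝ) :
    |(f (t + h) - f t) / h| ≤ L := by
  rcases eq_or_ne h 0 with rfl | hh
  · simp
  · rw [abs_div, div_le_iff₀ (abs_pos.2 hh)]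
    simpa [Real.dist_eq] using hf.dist_le_mul (t + h) t

theorem LipschitzWith.isBoundedUnder_ge_slope (hf : LipschitzWith L f) (t : ℝ) :
    IsBoundedUnder (· ≥ ·) (nhdsWithin 0 {(0 : ℝ)}ᶜ) fun h => (f (t + h) - f t) / h :=
  isBoundedUnder_of ⟨-L, fun h => (abs_le.1 (hf.abs_slope_le t h)).1⟩

theorem LipschitzWith.isCoboundedUnder_ge_slope (hf : LipschitzWith L f) (t : ℝ) :
    IsCoboundedUnder (· ≥ ·) (nhdsWithin 0 {(0 : ℝ)}ᶜ) fun h => (f (t + h) - f t) / h :=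
  IsBoundedUnder.isCoboundedUnder_ge
    (isBoundedUnder_of ⟨L, fun h => (abs_le.1 (hf.abs_slope_le t h)).2⟩)

theorem LipschitzWith.abs_lowerDeriv_le (hf : LipschitzWith L f) (t : ℝ) :
    |lowerDeriv f t| ≤ L := by
  refine abs_le.2 ⟨?_, ?_⟩
  · exact le_liminf_of_le (hf.isCoboundedUnder_ge_slope t)
      (Eventually.of_forall fun h => (abs_le.1 (hf.abs_slope_le t h)).1)
  · exact liminf_le_of_frequently_le
      (Eventually.of_forall fun h => (abs_le.1 (hf.abs_slope_le t h)).2).frequently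
      (hf.isBoundedUnder_ge_slope t)

theorem LipschitzWith.measurable_lowerDeriv (hf : LipschitzWith L f) :
    Measurable (lowerDeriv f) := by
  refine measurable_of_Ioi fun a => ?_
  have key : lowerDeriv f ⁻¹' Ioi a = ⋃ (b : {b : ℚ // a < b}) (k : ℕ),
      ⋂ (h : ℝ) (_ : h ≠ 0) (_ : |h| < 1 / ((k : ℝ) + 1)),
        {t | ((b : ℚ) : ℝ) ≤ (f (t + h) - f t) / h} := by
    ext t
    simp only [mem_preimage, mem_Ioi, mem_iUnion, mem_iInter, mem_ofPred_eq]
    constructor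
    · intro h
      obtain ⟨b, hab, hb⟩ := exists_rat_btwn h
      have hev := eventually_lt_of_lt_liminf hb (hf.isBoundedUnder_ge_slope t)
      rw [eventually_nhdsWithin_iff, Metric.eventually_nhds_iff] at hev
      obtain ⟨ε, hε, hev⟩ := hev
      obtain ⟨k, hk⟩ := exists_nat_one_div_lt hε
      refine ⟨⟨b, hab⟩, k, fun s hs hsk => (hev ?_ hs).le⟩
      simpa using hsk.trans hk
    · rintro ⟨⟨b, hab⟩, k, h⟩
      refine lt_of_lt_of_le hab (le_liminf_of_le (hf.isCoboundedUnder_ge_slope t) ?_)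
      rw [eventually_nhdsWithin_iff, Metric.eventually_nhds_iff]
      exact ⟨1 / ((k : ℝ) + 1), by positivity, fun s hs hs0 => h s hs0 (by simpa using hs)⟩
  rw [key]
  refine .iUnion fun b => .iUnion fun k => IsClosed.measurableSet ?_
  refine isClosed_iInter fun h => isClosed_iInter fun _ => isClosed_iInter fun _ => ?_
  have := hf.continuous
  exact isClosed_le continuous_const (by fun_prop)

theorem HasDerivAt.lowerDeriv_eq {d t : ℝ} (h : HasDerivAt f d t) : lowerDeriv f t = d := by
  refine Tendsto.liminf_eq ?_
  simpa [div_eq_inv_mul] using hasDerivAt_iff_tendsto_slope_zero.1 h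

theorem lowerDeriv_congr {g : ℝ → ℝ} {t : ℝ} (h : f =ᶠ[𝓝 t] g) :
    lowerDeriv f t = lowerDeriv g t := by
  refine liminf_congr (Eventually.filter_mono nhdsWithin_le_nhds ?_)
  have : Tendsto (fun s : ℝ => t + s) (𝓝 0) (𝓝 t) :=
    Continuous.tendsto' (by fun_prop) 0 t (by simp)
  filter_upwards [this.eventually h] with s hs
  rw [hs, h.eq_of_nhds]

theorem LipschitzWith.deriv_comp_eq_lowerDeriv_mul (hf : LipschitzWith L f) {γ : ℝ → ℝ}
    {d d' s : ℝ} (hγ : HasStrictDerivAt γ d s) (hfγ : HasDerivAt (f ∘ γ) d' s) :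
    d' = lowerDeriv f (γ s) * d := by
  rcases eq_or_ne d 0 with rfl | hd
  · have h0 : HasDerivAt (f ∘ γ) 0 s := by
      rw [hasDerivAt_iff_isLittleO]
      have h1 := hγ.hasDerivAt
      rw [hasDerivAt_iff_isLittleO] at h1
      simp only [smul_zero, sub_zero] at h1 ⊢
      refine Asymptotics.IsBigO.trans_isLittleO ?_ h1
      refine Asymptotics.IsBigO.of_bound L (Eventually.of_forall fun x => ?_)
      simpa [Real.dist_eq] using hf.dist_le_mul (γ x) (γ s)
    simpa using hfγ.unique h0
  · have h1 := (hγ.to_localInverse hd).hasDerivAt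
    have h2 : hγ.localInverse γ d s hd (γ s) = s := (hγ.eventually_left_inverse hd).self_of_nhds
    have h3 : HasDerivAt ((f ∘ γ) ∘ hγ.localInverse γ d s hd) (d' * d⁻¹) (γ s) :=
      HasDerivAt.comp _ (by rwa [h2]) h1
    have h4 : HasDerivAt f (d' * d⁻¹) (γ s) := by
      refine h3.congr_of_eventuallyEq ?_
      filter_upwards [hγ.eventually_right_inverse hd] with x hx
      simp [hx]
    rw [h4.lowerDeriv_eq]
    field_simp

end LowerDerivative

theorem integrable_of_bound_of_eq_zero {X : Type*} [TopologicalSpace X] [MeasurableSpace X]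
    {μ : Measure X} [IsFiniteMeasureOnCompacts μ] {g : X → ℝ} {S : Set X} (hS : IsCompact S)
    (hg : AEStronglyMeasurable g μ) (M : ℝ)
    (hM : ∀ᵐ x ∂μ, |g x| ≤ M) (h0 : ∀ x ∉ S, g x = 0) : Integrable g μ := by
  rw [← integrableOn_iff_integrable_of_support_subset (s := S)
    fun x hx => by_contra fun h => hx (h0 x h)]
  exact Measure.integrableOn_of_bounded hS.measure_lt_top.ne hg (M := M)
    (ae_restrict_of_ae hM)

theorem lineDeriv_eq_zero_of_notMem_tsupport {E : Type*} [NormedAddCommGroup E]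
    [NormedSpace ℝ E] {ψ : E → ℝ} {x : E} (hx : x ∉ tsupport ψ) (v : E) :
    lineDeriv ℝ ψ x v = 0 := by
  have h : ψ =ᶠ[𝓝 x] fun _ => 0 := notMem_tsupport_iff_eventuallyEq.1 hx
  rw [h.lineDeriv_eq]
  simp [lineDeriv]

theorem LipschitzWith.exists_lipschitzWith_mul {X : Type*} [PseudoMetricSpace X] {a b : X → ℝ}
    {A B : ℝ≥0} {M N : ℝ} (ha : LipschitzWith A a) (hb : LipschitzWith B b)
    (haM : ∀ x, |a x| ≤ M) (hbN : ∀ x, |b x| ≤ N) :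
    ∃ C, LipschitzWith C fun x => a x * b x := by
  refine ⟨M.toNNReal * B + N.toNNReal * A, LipschitzWith.of_dist_le_mul fun x y => ?_⟩
  have hM : 0 ≤ M := (abs_nonneg _).trans (haM x)
  have hN : 0 ≤ N := (abs_nonneg _).trans (hbN x)
  have h1 := ha.dist_le_mul x y
  have h2 := hb.dist_le_mul x y
  rw [Real.dist_eq] at h1 h2 ⊢
  calc |a x * b x - a y * b y| = |a x * (b x - b y) + b y * (a x - a y)| := by congr 1; ring
    _ ≤ |a x| * |b x - b y| + |b y| * |a x - a y| := by
      simpa only [abs_mul] using abs_add_le (a x * (b x - b y)) (b y * (a x - a y))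
    _ ≤ M * (B * dist x y) + N * (A * dist x y) := by
      gcongr
      · exact haM x
      · exact hbN y
    _ = _ := by
      push_cast [Real.coe_toNNReal _ hM, Real.coe_toNNReal _ hN]
      ring

section LipschitzIntegrals

variable {E : Type*} [NormedAddCommGroup E] [NormedSpace ℝ E] [MeasurableSpace E] [BorelSpace E]
  {μ : Measure E} {C D : ℝ≥0} {φ ψ : E → ℝ}

variable [μ.IsAddHaarMeasure]

theorem LipschitzWith.integrable_lineDeriv (hψ : LipschitzWith C ψ) (hψc : HasCompactSupport ψ)
    (v : E) : Integrable (fun x => lineDeriv ℝ ψ x v) μ :=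
  integrable_of_bound_of_eq_zero hψc (aestronglyMeasurable_lineDeriv hψ.continuous μ) (C * ‖v‖)
    (.of_forall fun _ => norm_lineDeriv_le_of_lipschitz ℝ hψ)
    fun _ hx => lineDeriv_eq_zero_of_notMem_tsupport hx v

theorem LipschitzWith.integrable_mul_lineDeriv (hψ : LipschitzWith C ψ)
    (hψc : HasCompactSupport ψ) (v : E) {g : E → ℝ} (hg : Continuous g) :
    Integrable (fun x => g x * lineDeriv ℝ ψ x v) μ := by
  obtain ⟨M, hM⟩ := IsCompact.exists_bound_of_continuousOn hψc hg.continuousOn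
  refine integrable_of_bound_of_eq_zero hψc (hg.aestronglyMeasurable.mul
    (aestronglyMeasurable_lineDeriv hψ.continuous μ)) (|M| * (C * ‖v‖)) (.of_forall fun x => ?_)
    fun _ hx => by rw [lineDeriv_eq_zero_of_notMem_tsupport hx v, mul_zero]
  by_cases hx : x ∈ tsupport ψ
  · rw [abs_mul]
    exact mul_le_mul ((hM x hx).trans (le_abs_self M)) (norm_lineDeriv_le_of_lipschitz ℝ hψ)
      (abs_nonneg _) (abs_nonneg _)
  · rw [lineDeriv_eq_zero_of_notMem_tsupport hx v, mul_zero, abs_zero]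
    positivity

theorem LipschitzWith.integrable_mul_lineDeriv_sq (hψ : LipschitzWith C ψ)
    (hψc : HasCompactSupport ψ) (v : E) {g : E → ℝ} (hg : Continuous g) :
    Integrable (fun x => g x * lineDeriv ℝ ψ x v ^ 2) μ := by
  have h := (hψ.integrable_mul_lineDeriv (μ := μ) hψc v hg).mul_bdd (c := C * ‖v‖)
    (aestronglyMeasurable_lineDeriv hψ.continuous μ)
    (.of_forall fun _ => norm_lineDeriv_le_of_lipschitz ℝ hψ)
  simpa only [pow_two, mul_assoc] using h

variable [FiniteDimensional ℝ E]

theorem LipschitzWith.integral_lineDeriv_mul_lineDeriv_comm (hφ : LipschitzWith C φ)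
    (hφc : HasCompactSupport φ) (hψ : LipschitzWith D ψ) (hψc : HasCompactSupport ψ) (a b : E) :
    ∫ x, lineDeriv ℝ φ x a * lineDeriv ℝ ψ x b ∂μ =
      ∫ x, lineDeriv ℝ φ x b * lineDeriv ℝ ψ x a ∂μ := by
  have A := integral_inv_smul_sub_mul_tendsto_integral_lineDeriv_mul hψ
    (hφ.integrable_lineDeriv hφc (μ := μ) a) b
  have B := integral_inv_smul_sub_mul_tendsto_integral_lineDeriv_mul hφ
    (hψ.integrable_lineDeriv hψc (μ := μ) (-a)) (-b)
  have key : ∀ t : ℝ, ∫ x, (t⁻¹ • (ψ (x + t • b) - ψ x)) * lineDeriv ℝ φ x a ∂μ =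
      ∫ x, (t⁻¹ • (φ (x + t • -b) - φ x)) * lineDeriv ℝ ψ x (-a) ∂μ := by
    intro t
    have hψt : LipschitzWith D fun x => ψ (x + t • b) := by
      have h := hψ.comp ((LipschitzWith.id (α := E)).add (LipschitzWith.const (t • b)))
      simpa [Function.comp_def] using h
    have hψtc : HasCompactSupport fun x => ψ (x + t • b) :=
      hψc.comp_homeomorph (Homeomorph.addRight (t • b))
    have h1 := integral_lineDeriv_mul_eq (μ := μ) hφ hψ hψc a
    have h2 := integral_lineDeriv_mul_eq (μ := μ) hφ hψt hψtc a
    have h3 : ∀ x, lineDeriv ℝ (fun x => ψ (x + t • b)) x (-a) =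
        lineDeriv ℝ ψ (x + t • b) (-a) := by
      intro x
      simp only [lineDeriv, add_right_comm]
    have h4 : ∫ x, lineDeriv ℝ (fun x => ψ (x + t • b)) x (-a) * φ x ∂μ =
        ∫ x, lineDeriv ℝ ψ x (-a) * φ (x + t • -b) ∂μ := by
      simp_rw [h3]
      rw [← integral_add_right_eq_self _ (t • -b)]
      simp
    have i1 : Integrable (fun x => ψ (x + t • b) * lineDeriv ℝ φ x a) μ :=
      hφ.integrable_mul_lineDeriv hφc a hψt.continuous
    have i2 : Integrable (fun x => ψ x * lineDeriv ℝ φ x a) μ :=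
      hφ.integrable_mul_lineDeriv hφc a hψ.continuous
    have i3 : Integrable (fun x => φ (x + t • -b) * lineDeriv ℝ ψ x (-a)) μ :=
      hψ.integrable_mul_lineDeriv hψc (-a) (hφ.continuous.comp (continuous_add_const _))
    have i4 : Integrable (fun x => φ x * lineDeriv ℝ ψ x (-a)) μ :=
      hψ.integrable_mul_lineDeriv hψc (-a) hφ.continuous
    simp only [smul_eq_mul, mul_assoc, integral_const_mul, sub_mul]
    rw [integral_sub i1 i2, integral_sub i3 i4]
    simp only [mul_comm (ψ _), mul_comm (φ _)]
    rw [h1, h2, h4]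
  simp only [key] at A
  have := tendsto_nhds_unique A B
  simpa [lineDeriv_neg, mul_comm] using this

theorem LipschitzWith.exists_smooth_approx (hψ : LipschitzWith C ψ) (hψc : HasCompactSupport ψ)
    {V : Set E} (hV : IsOpen V) (hψV : tsupport ψ ⊆ V) :
    ∃ (S : Set E) (ξ : ℕ → E → ℝ), IsCompact S ∧ S ⊆ V ∧
      (∀ k, ContDiff ℝ (⊤ : ℕ∞) (ξ k)) ∧ (∀ k, tsupport (ξ k) ⊆ S) ∧
      (∀ k, LipschitzWith C (ξ k)) ∧ (∃ M, ∀ k x, |ξ k x| ≤ M) ∧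
      (∀ x, Tendsto (ξ · x) atTop (𝓝 (ψ x))) ∧
      ∀ v, ∀ᵐ x ∂μ, Tendsto (fun k => fderiv ℝ (ξ k) x v) atTop (𝓝 (lineDeriv ℝ ψ x v)) := by
  obtain ⟨δ, hδ, hδV⟩ := IsCompact.exists_cthickening_subset_open hψc hV hψV
  let ρ : ℕ → ContDiffBump (0 : E) := fun k =>
    ⟨δ / (k + 1) / 2, δ / (k + 1), by positivity, half_lt_self (by positivity)⟩
  have hρ : Tendsto (fun k => (ρ k).rOut) atTop (𝓝 0) :=
    tendsto_const_div_atTop_nhds_zero_nat δ |>.comp (tendsto_add_atTop_nat 1) |>.congr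
      fun k => by simp [ρ]
  have hρδ : ∀ k, (ρ k).rOut ≤ δ := fun k =>
    div_le_self hδ.le (by have : (0 : ℝ) ≤ k := k.cast_nonneg
                          linarith)
  let ξ : ℕ → E → ℝ := fun k => (ρ k).normed μ ⋆[ContinuousLinearMap.lsmul ℝ ℝ, μ] ψ
  have hξ_apply : ∀ k x, ξ k x = ∫ t, (ρ k).normed μ t * ψ (x - t) ∂μ := fun k x => rfl
  have hinteg : ∀ k {g : E → ℝ}, Continuous g → Integrable (fun t => (ρ k).normed μ t * g t) μ :=
    fun k g hg => ((ρ k).continuous_normed.mul hg).integrable_of_hasCompactSupport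
      (ρ k).hasCompactSupport_normed.mul_right
  have hsmooth : ∀ k, ContDiff ℝ (⊤ : ℕ∞) (ξ k) := fun k =>
    (ρ k).hasCompactSupport_normed.contDiff_convolution_left _ (ρ k).contDiff_normed
      hψ.continuous.locallyIntegrable
  refine ⟨cthickening δ (tsupport ψ), ξ, IsCompact.cthickening hψc, hδV, hsmooth, fun k => ?_,
    fun k => ?_, ?_, fun x => ?_, fun v => ?_⟩
  · refine closure_minimal ((support_convolution_subset _).trans ?_) isClosed_cthickening
    rintro _ ⟨a, ha, b, hb, rfl⟩
    rw [(ρ k).support_normed_eq, mem_ball_zero_iff] at ha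
    refine mem_cthickening_of_dist_le _ b δ _ (subset_tsupport _ hb) ?_
    simpa using ha.le.trans (hρδ k)
  · refine LipschitzWith.of_dist_le_mul fun x y => ?_
    have hsub : ∀ z, Integrable (fun t => (ρ k).normed μ t * ψ (z - t)) μ := fun z =>
      hinteg k (hψ.continuous.comp (continuous_sub_left z))
    rw [Real.dist_eq, hξ_apply, hξ_apply, ← integral_sub (hsub x) (hsub y), ← Real.norm_eq_abs]
    refine (norm_integral_le_of_norm_le (μ := μ) (g := fun t => (ρ k).normed μ t * (C * dist x y))
      (hinteg k continuous_const) (.of_forall fun t => ?_)).trans ?_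
    · rw [← mul_sub, norm_mul, Real.norm_of_nonneg ((ρ k).nonneg_normed t)]
      refine mul_le_mul_of_nonneg_left ?_ ((ρ k).nonneg_normed t)
      simpa [dist_eq_norm] using hψ.dist_le_mul (x - t) (y - t)
    · rw [integral_mul_const, (ρ k).integral_normed, one_mul]
  · obtain ⟨M, hM⟩ := hψc.exists_bound_of_continuous hψ.continuous
    refine ⟨M, fun k x => ?_⟩
    rw [hξ_apply, ← Real.norm_eq_abs]
    refine (norm_integral_le_of_norm_le (μ := μ) (g := fun t => (ρ k).normed μ t * M)
      (hinteg k continuous_const) (.of_forall fun t => ?_)).trans ?_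
    · rw [norm_mul, Real.norm_of_nonneg ((ρ k).nonneg_normed t)]
      exact mul_le_mul_of_nonneg_left (hM _) ((ρ k).nonneg_normed t)
    · rw [integral_mul_const, (ρ k).integral_normed, one_mul]
  · exact ContDiffBump.convolution_tendsto_right_of_continuous hρ hψ.continuous x
  · have hder : ∀ k x, fderiv ℝ (ξ k) x v =
        ((ρ k).normed μ ⋆[ContinuousLinearMap.lsmul ℝ ℝ, μ] fun y => lineDeriv ℝ ψ y v) x := by
      intro k x
      rw [← ((hsmooth k).differentiable (by simp) x).lineDeriv_eq_fderiv]
      have hmeas : AEStronglyMeasurable (fun t => (ρ k).normed μ t * lineDeriv ℝ ψ (x - t) v) μ :=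
        (ρ k).continuous_normed.aestronglyMeasurable.mul
          ((measurable_lineDeriv hψ.continuous).comp
            (measurable_const_sub x)).aestronglyMeasurable
      have hae : ∀ᵐ t ∂μ, LineDifferentiableAt ℝ ψ (x - t) v :=
        (quasiMeasurePreserving_sub_left μ x).tendsto_ae
          (hψ.ae_lineDifferentiableAt v)
      refine HasDerivAt.deriv (f := fun s : ℝ => ξ k (x + s • v))
        (hasDerivAt_integral_of_dominated_loc_of_lip
          (F := fun s t => (ρ k).normed μ t * ψ (x + s • v - t))
          (F' := fun t => (ρ k).normed μ t * lineDeriv ℝ ψ (x - t) v)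
          (bound := fun t => (ρ k).normed μ t * (C * ‖v‖)) univ_mem
          (.of_forall fun s => ?_) ?_ hmeas (.of_forall fun t => ?_)
          (hinteg k continuous_const) ?_).2
      · exact (hinteg k (hψ.continuous.comp (continuous_sub_left (x + s • v)))).aestronglyMeasurable
      · exact hinteg k (hψ.continuous.comp (continuous_sub_left _))
      · refine LipschitzWith.lipschitzOnWith (LipschitzWith.of_dist_le_mul fun r s => ?_)
        have h0 := (ρ k).nonneg_normed (μ := μ) t
        have h1 := hψ.dist_le_mul (x + r • v - t) (x + s • v - t)
        rw [Real.coe_nnabs, abs_of_nonneg (by positivity), Real.dist_eq, ← mul_sub, abs_mul,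
          abs_of_nonneg h0, mul_assoc]
        refine mul_le_mul_of_nonneg_left ?_ h0
        rw [dist_sub_right, dist_add_left, dist_eq_norm (r • v), ← sub_smul, norm_smul] at h1
        rw [Real.dist_eq] at h1 ⊢
        rw [Real.norm_eq_abs] at h1
        linarith
      · filter_upwards [hae] with t ht
        have := (ht.hasLineDerivAt).const_mul ((ρ k).normed μ t)
        simpa only [sub_add_eq_add_sub] using this
    filter_upwards [ContDiffBump.ae_convolution_tendsto_right_of_locallyIntegrable (K := 2) hρ
      (.of_forall fun k => le_of_eq (by simp only [ρ]; ring))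
      (hψ.locallyIntegrable_lineDeriv (μ := μ) v)] with x hx
    simpa only [hder] using hx

end LipschitzIntegrals

section Stability

variable {n : ℕ}

theorem norm_stdBasis (i : Fin n) : ‖stdBasis n i‖ = 1 := by
  simp [stdBasis]

theorem norm_gradient_sq (w : Euc n → ℝ) (x : Euc n) :
    ‖gradient w x‖ ^ 2 = ∑ i, fderiv ℝ w x (stdBasis n i) ^ 2 := by
  rw [EuclideanSpace.norm_sq_eq]
  refine Finset.sum_congr rfl fun i _ => ?_
  have h : inner ℝ (gradient w x) (stdBasis n i) = fderiv ℝ w x (stdBasis n i) :=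
    InnerProductSpace.toDual_symm_apply
  rw [← h, stdBasis, EuclideanSpace.inner_single_right]
  simp

theorem LipschitzWith.abs_lineDeriv_stdBasis_le {ψ : Euc n → ℝ} {C : ℝ≥0}
    (hψ : LipschitzWith C ψ) (x : Euc n) (i : Fin n) :
    |lineDeriv ℝ ψ x (stdBasis n i)| ≤ C := by
  simpa [norm_stdBasis] using norm_lineDeriv_le_of_lipschitz ℝ (x₀ := x) (v := stdBasis n i) hψ

theorem stability_of_lipschitzWith {c : Euc n → ℝ} (hc : Measurable c) {L : ℝ}
    (hcL : ∀ x, |c x| ≤ L) {V : Set (Euc n)} (hV : IsOpen V)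
    (hstab : ∀ ξ : Euc n → ℝ, ContDiff ℝ (⊤ : ℕ∞) ξ → HasCompactSupport ξ → tsupport ξ ⊆ V →
      ∫ x, c x * ξ x ^ 2 ≤ ∫ x, ‖gradient ξ x‖ ^ 2)
    {ψ : Euc n → ℝ} {C : ℝ≥0} (hψ : LipschitzWith C ψ) (hψc : HasCompactSupport ψ)
    (hψV : tsupport ψ ⊆ V) :
    ∫ x, c x * ψ x ^ 2 ≤ ∫ x, ∑ i, lineDeriv ℝ ψ x (stdBasis n i) ^ 2 := by
  obtain ⟨S, ξ, hS, hSV, hsm, hξS, hξC, ⟨M, hM⟩, hlim, hdlim⟩ :=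
    hψ.exists_smooth_approx (μ := volume) hψc hV hψV
  have hind : ∀ N : ℝ, Integrable (S.indicator fun _ => N) (volume : Measure (Euc n)) := fun N =>
    (integrable_indicator_iff hS.measurableSet).2 (integrableOn_const hS.measure_lt_top.ne)
  refine le_of_tendsto_of_tendsto'
    (tendsto_integral_of_dominated_convergence (F := fun k x => c x * ξ k x ^ 2)
      (S.indicator fun _ => L * M ^ 2) (fun k => ?_) (hind _) (fun k => .of_forall fun x => ?_)
      (.of_forall fun x => ((hlim x).pow 2).const_mul (c x)))
    (tendsto_integral_of_dominated_convergence
      (F := fun k x => ∑ i, fderiv ℝ (ξ k) x (stdBasis n i) ^ 2)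
      (S.indicator fun _ => n * (C : ℝ) ^ 2) (fun k => ?_) (hind _)
      (fun k => .of_forall fun x => ?_) ?_)
    fun k => ?_
  · exact (hc.mul ((hsm k).continuous.measurable.pow_const 2)).aestronglyMeasurable
  · by_cases hx : x ∈ S
    · rw [indicator_of_mem hx, norm_mul, norm_pow]
      have h1 := hcL x
      have h2 := hM k x
      exact mul_le_mul h1 (pow_le_pow_left₀ (abs_nonneg _) h2 2) (by positivity)
        ((abs_nonneg _).trans h1)
    · rw [indicator_of_notMem hx, image_eq_zero_of_notMem_tsupport fun h => hx (hξS k h)]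
      simp
  · exact (Finset.measurable_fun_sum _ fun i _ =>
      (measurable_fderiv_apply_const ℝ (ξ k) _).pow_const 2).aestronglyMeasurable
  · by_cases hx : x ∈ S
    · rw [indicator_of_mem hx, Real.norm_of_nonneg (by positivity)]
      refine (Finset.sum_le_card_nsmul _ _ ((C : ℝ) ^ 2) fun i _ => ?_).trans (by simp)
      rw [← ((hsm k).differentiable (by simp) x).lineDeriv_eq_fderiv]
      exact sq_le_sq' (abs_le.1 ((hξC k).abs_lineDeriv_stdBasis_le x i)).1
        (abs_le.1 ((hξC k).abs_lineDeriv_stdBasis_le x i)).2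
    · rw [indicator_of_notMem hx]
      have h0 : ∀ i, fderiv ℝ (ξ k) x (stdBasis n i) = 0 := fun i => by
        rw [← ((hsm k).differentiable (by simp) x).lineDeriv_eq_fderiv]
        exact lineDeriv_eq_zero_of_notMem_tsupport (fun h => hx (hξS k h)) _
      simp [h0]
  · filter_upwards [ae_all_iff.2 fun i => hdlim (stdBasis n i)] with x hx
    exact tendsto_finsetSum _ fun i _ => (hx i).pow 2
  · have := hstab (ξ k) (hsm k) (hS.of_isClosed_subset (isClosed_tsupport _) (hξS k))
      ((hξS k).trans hSV)
    simpa only [norm_gradient_sq] using this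

end Stability

section WeakEquation

variable {n : ℕ}

/-- The `i`-th partial derivative of `v`. -/
def partialDeriv (i : Fin n) (v : Euc n → ℝ) (x : Euc n) : ℝ := fderiv ℝ v x (stdBasis n i)

theorem ContDiff.partialDeriv {v : Euc n → ℝ} {m k : ℕ∞} (hv : ContDiff ℝ m v) (hk : k + 1 ≤ m)
    (i : Fin n) : ContDiff ℝ k (partialDeriv i v) :=
  (hv.fderiv_right (by exact_mod_cast hk)).clm_apply contDiff_const

theorem HasCompactSupport.partialDeriv {v : Euc n → ℝ} (hv : HasCompactSupport v) (i : Fin n) :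
    HasCompactSupport (partialDeriv i v) :=
  hv.fderiv_apply ℝ _

theorem iteratedFDeriv_two_stdBasis {v : Euc n → ℝ} (hv : ContDiff ℝ 2 v) (i j : Fin n)
    (x : Euc n) : iteratedFDeriv ℝ 2 v x ![stdBasis n i, stdBasis n j] =
      partialDeriv i (partialDeriv j v) x := by
  have h : DifferentiableAt ℝ (fderiv ℝ v) x :=
    (hv.fderiv_right (m := 1) (by norm_num)).differentiable (by simp) x
  rw [iteratedFDeriv_two_apply]
  unfold partialDeriv
  rw [fderiv_clm_apply h (differentiableAt_const _)]
  simp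

theorem partialDeriv_comm {v : Euc n → ℝ} (hv : ContDiff ℝ 2 v) (i j : Fin n) (x : Euc n) :
    partialDeriv i (partialDeriv j v) x = partialDeriv j (partialDeriv i v) x := by
  rw [← iteratedFDeriv_two_stdBasis hv, ← iteratedFDeriv_two_stdBasis hv,
    iteratedFDeriv_two_apply, iteratedFDeriv_two_apply]
  exact hv.contDiffAt.isSymmSndFDerivAt (by simp) _ _

theorem lineDeriv_comp_eq_lowerDeriv_mul {f : ℝ → ℝ} {L : ℝ≥0} (hf : LipschitzWith L f)
    {v : Euc n → ℝ} (hv : ContDiff ℝ 1 v) {x e : Euc n}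
    (hx : LineDifferentiableAt ℝ (f ∘ v) x e) :
    lineDeriv ℝ (f ∘ v) x e = lowerDeriv f (v x) * fderiv ℝ v x e := by
  have h1 : HasStrictDerivAt (fun s : ℝ => v (x + s • e)) (fderiv ℝ v x e) 0 := by
    have h2 : HasStrictFDerivAt v (fderiv ℝ v x) (x + (0 : ℝ) • e) := by
      simpa using hv.contDiffAt.hasStrictFDerivAt (by simp)
    have h3 : HasStrictDerivAt (fun s : ℝ => x + s • e) e 0 := by
      simpa using ((hasStrictDerivAt_id (0 : ℝ)).smul_const e).const_add x
    exact h2.comp_hasStrictDerivAt 0 h3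
  simpa using hf.deriv_comp_eq_lowerDeriv_mul h1 hx.hasLineDerivAt

theorem integral_weak_linearized {f : ℝ → ℝ} {L : ℝ≥0} (hf : LipschitzWith L f)
    {v : Euc n → ℝ} (hv : ContDiff ℝ 2 v) (hvc : HasCompactSupport v) {ψ : Euc n → ℝ} {C : ℝ≥0}
    (hψ : LipschitzWith C ψ) (hψc : HasCompactSupport ψ)
    (heq : ∀ x ∈ tsupport ψ, lapl v x = -f (v x)) (i : Fin n) :
    ∫ x, ∑ j, partialDeriv j (partialDeriv i v) x * lineDeriv ℝ ψ x (stdBasis n j) =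
      ∫ x, lowerDeriv f (v x) * partialDeriv i v x * ψ x := by
  have hP : ∀ j, ContDiff ℝ 1 (partialDeriv j v) := fun j =>
    hv.partialDeriv (m := 2) (k := 1) (by norm_num) j
  have hPL : ∀ j, ∃ D, LipschitzWith D (partialDeriv j v) := fun j =>
    ContDiff.lipschitzWith_of_hasCompactSupport (hvc.partialDeriv j) (hP j) (by simp)
  have hline : ∀ j k x, lineDeriv ℝ (partialDeriv j v) x (stdBasis n k) =
      partialDeriv k (partialDeriv j v) x := fun j k x =>
    ((hP j).differentiable (by simp) x).lineDeriv_eq_fderiv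
  have hinteg : ∀ j k l, Integrable fun x =>
      partialDeriv j (partialDeriv k v) x * lineDeriv ℝ ψ x (stdBasis n l) := fun j k l =>
    hψ.integrable_mul_lineDeriv hψc _
      ((hP k).partialDeriv (m := 1) (k := 0) (by norm_num) j).continuous
  obtain ⟨D, hD⟩ : ∃ D, LipschitzWith D v :=
    ContDiff.lipschitzWith_of_hasCompactSupport hvc hv (by simp)
  have hfv : LipschitzWith (L * D) (f ∘ v) := hf.comp hD
  calc ∫ x, ∑ j, partialDeriv j (partialDeriv i v) x * lineDeriv ℝ ψ x (stdBasis n j)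
      = ∑ j, ∫ x, partialDeriv j (partialDeriv i v) x * lineDeriv ℝ ψ x (stdBasis n j) :=
        integral_finsetSum _ fun j _ => hinteg j i j
    _ = ∑ j, ∫ x, partialDeriv j (partialDeriv j v) x * lineDeriv ℝ ψ x (stdBasis n i) := by
        refine Finset.sum_congr rfl fun j _ => ?_
        obtain ⟨D, hD⟩ := hPL j
        have := hD.integral_lineDeriv_mul_lineDeriv_comm (μ := volume) (hvc.partialDeriv j) hψ hψc
          (stdBasis n i) (stdBasis n j)
        simpa only [hline, partialDeriv_comm hv j i] using this
    _ = ∫ x, ∑ j, partialDeriv j (partialDeriv j v) x * lineDeriv ℝ ψ x (stdBasis n i) :=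
        (integral_finsetSum _ fun j _ => hinteg j j i).symm
    _ = ∫ x, lineDeriv ℝ ψ x (-stdBasis n i) * (f ∘ v) x := by
        refine integral_congr_ae (.of_forall fun x => ?_)
        by_cases hx : x ∈ tsupport ψ
        · have h := heq x hx
          simp only [lapl, iteratedFDeriv_two_stdBasis hv] at h
          simp only [← Finset.sum_mul, h, lineDeriv_neg, Function.comp_apply]
          ring
        · simp [lineDeriv_eq_zero_of_notMem_tsupport hx]
    _ = ∫ x, lineDeriv ℝ (f ∘ v) x (stdBasis n i) * ψ x :=
        (hfv.integral_lineDeriv_mul_eq hψ hψc _).symm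
    _ = _ := by
        refine integral_congr_ae ?_
        filter_upwards [hfv.ae_lineDifferentiableAt (stdBasis n i)] with x hx
        rw [lineDeriv_comp_eq_lowerDeriv_mul hf (hv.of_le (by norm_num)) hx]
        rfl

end WeakEquation

section GeometricInequality

variable {n : ℕ}

theorem norm_gradient_sq_eq_sum_partialDeriv (v : Euc n → ℝ) (x : Euc n) :
    ‖gradient v x‖ ^ 2 = ∑ i, partialDeriv i v x ^ 2 :=
  norm_gradient_sq v x

theorem gradient_eq_zero_iff_fderiv_eq_zero {v : Euc n → ℝ} {x : Euc n} :
    gradient v x = 0 ↔ fderiv ℝ v x = 0 :=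
  (InnerProductSpace.toDual ℝ (Euc n)).symm.map_eq_zero_iff

theorem Asq_eq {v : Euc n → ℝ} (hv : ContDiff ℝ 2 v) {x : Euc n} (hx : fderiv ℝ v x ≠ 0) :
    Asq v x = (∑ i, ∑ j, partialDeriv j (partialDeriv i v) x ^ 2) -
      ∑ j, (∑ i, partialDeriv i v x * partialDeriv j (partialDeriv i v) x) ^ 2 /
        ∑ i, partialDeriv i v x ^ 2 := by
  rw [Asq, if_neg hx, ← norm_gradient_sq_eq_sum_partialDeriv, Finset.sum_comm]
  simp only [iteratedFDeriv_two_stdBasis hv]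
  congr 1
  refine Finset.sum_congr rfl fun j _ => ?_
  rw [← Finset.sum_div, div_pow]
  congr 2
  exact Finset.sum_congr rfl fun i _ => mul_comm _ _

theorem sum_partialDeriv_sq_pos {v : Euc n → ℝ} {x : Euc n} (hx : fderiv ℝ v x ≠ 0) :
    0 < ∑ i, partialDeriv i v x ^ 2 := by
  rw [← norm_gradient_sq_eq_sum_partialDeriv]
  have : gradient v x ≠ 0 := fun h => hx (gradient_eq_zero_iff_fderiv_eq_zero.1 h)
  positivity

theorem Asq_nonneg {v : Euc n → ℝ} (hv : ContDiff ℝ 2 v) (x : Euc n) : 0 ≤ Asq v x := by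
  by_cases hx : fderiv ℝ v x = 0
  · rw [Asq, if_pos hx]
  · rw [Asq_eq hv hx, Finset.sum_comm, sub_nonneg]
    refine Finset.sum_le_sum fun j _ => ?_
    rw [div_le_iff₀ (sum_partialDeriv_sq_pos hx), mul_comm]
    exact Finset.sum_mul_sq_le_sq_mul_sq _ _ _

theorem Asq_le {v : Euc n → ℝ} (hv : ContDiff ℝ 2 v) (x : Euc n) {δ : ℝ} (hδ : 0 < δ) :
    Asq v x ≤ (∑ i, ∑ j, partialDeriv j (partialDeriv i v) x ^ 2) -
      ∑ j, (∑ i, partialDeriv i v x * partialDeriv j (partialDeriv i v) x) ^ 2 /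
        ((∑ i, partialDeriv i v x ^ 2) + δ) := by
  by_cases hx : fderiv ℝ v x = 0
  · have h0 : ∀ i, partialDeriv i v x = 0 := fun i => by simp [partialDeriv, hx]
    rw [Asq, if_pos hx]
    simp only [h0]
    simp only [zero_mul, Finset.sum_const_zero, ne_eq, OfNat.ofNat_ne_zero, not_false_eq_true,
      zero_pow, zero_div, sub_zero]
    positivity
  · rw [Asq_eq hv hx]
    have hw := sum_partialDeriv_sq_pos hx
    gcongr
    linarith

theorem integral_Asq_mul_sq_le {f : ℝ → ℝ} {L : ℝ≥0} (hf : LipschitzWith L f)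
    {v : Euc n → ℝ} (hv : ContDiff ℝ 2 v) (hvc : HasCompactSupport v) {η : Euc n → ℝ} {K : ℝ≥0}
    (hη : LipschitzWith K η) (hηc : HasCompactSupport η) {V : Set (Euc n)} (hV : IsOpen V)
    (hηV : tsupport η ⊆ V) (heq : ∀ x ∈ V, lapl v x = -f (v x))
    (hstab : ∀ ξ : Euc n → ℝ, ContDiff ℝ (⊤ : ℕ∞) ξ → HasCompactSupport ξ → tsupport ξ ⊆ V →
      ∫ x, lowerDeriv f (v x) * ξ x ^ 2 ≤ ∫ x, ‖gradient ξ x‖ ^ 2) :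
    ∫ x, Asq v x * η x ^ 2 ≤ ∫ x, ‖gradient v x‖ ^ 2 * ‖gradient η x‖ ^ 2 := by
  set c : Euc n → ℝ := fun x => lowerDeriv f (v x) with hc_def
  set P : Fin n → Euc n → ℝ := fun i => partialDeriv i v with hP_def
  set H : Fin n → Fin n → Euc n → ℝ := fun i j => partialDeriv j (partialDeriv i v) with hH_def
  set w : Euc n → ℝ := fun x => ∑ i, P i x ^ 2 with hw_def
  set dη : Fin n → Euc n → ℝ := fun j x => lineDeriv ℝ η x (stdBasis n j) with hdη_def
  have hcm : Measurable c := hf.measurable_lowerDeriv.comp hv.continuous.measurable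
  have hcL : ∀ x, |c x| ≤ L := fun x => hf.abs_lowerDeriv_le _
  have hP : ∀ i, ContDiff ℝ 1 (P i) := fun i => hv.partialDeriv (m := 2) (k := 1) (by norm_num) i
  have hPc : ∀ i, HasCompactSupport (P i) := fun i => hvc.partialDeriv i
  have hH : ∀ i j, Continuous (H i j) := fun i j =>
    ((hP i).partialDeriv (m := 1) (k := 0) (by norm_num) j).continuous
  have hw : ContDiff ℝ 1 w := ContDiff.sum fun i _ => (hP i).pow 2
  have hw0 : ∀ x, 0 ≤ w x := fun x => Finset.sum_nonneg fun i _ => sq_nonneg _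
  have hwc : HasCompactSupport w := by
    refine HasCompactSupport.intro hvc fun x hx => ?_
    refine Finset.sum_eq_zero fun i _ => ?_
    have : P i x = 0 := by
      have h0 : v =ᶠ[𝓝 x] fun _ => 0 := notMem_tsupport_iff_eventuallyEq.1 hx
      simp [hP_def, partialDeriv, h0.fderiv_eq]
    simp [this]
  have hPline : ∀ i j x, HasDerivAt (fun t : ℝ => P i (x + t • stdBasis n j)) (H i j x) 0 := by
    intro i j x
    have := ((hP i).differentiable (by simp) x).lineDifferentiableAt (v := stdBasis n j)
    rw [show H i j x = lineDeriv ℝ (P i) x (stdBasis n j) from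
      (((hP i).differentiable (by simp) x).lineDeriv_eq_fderiv).symm]
    exact this.hasLineDerivAt
  have hci : ∀ g : Euc n → ℝ, Continuous g → HasCompactSupport g →
      Integrable fun x => c x * g x := fun g hg hgc =>
    (hg.integrable_of_hasCompactSupport hgc).bdd_mul hcm.aestronglyMeasurable
      (.of_forall hcL)
  obtain ⟨Mη, hMη⟩ := hηc.exists_bound_of_continuous hη.continuous
  have hsupp : ∀ g : Euc n → ℝ, tsupport (fun x => g x * η x) ⊆ tsupport η := fun g =>
    tsupport_mul_subset_right
  have hψ : ∀ i, ∃ D, LipschitzWith D fun x => P i x * η x * η x := by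
    intro i
    obtain ⟨A, hA⟩ := ContDiff.lipschitzWith_of_hasCompactSupport (hPc i) (hP i) (by simp)
    obtain ⟨M, hM⟩ := (hPc i).exists_bound_of_continuous (hP i).continuous
    obtain ⟨B, hB⟩ := hA.exists_lipschitzWith_mul hη hM hMη
    refine hB.exists_lipschitzWith_mul hη (M := M * Mη) (fun x => ?_) hMη
    rw [abs_mul]
    exact mul_le_mul (hM x) (hMη x) (abs_nonneg _) ((abs_nonneg _).trans (hM x))
  have hweak : ∀ i, ∫ x, ∑ j, H i j x *
      lineDeriv ℝ (fun x => P i x * η x * η x) x (stdBasis n j) =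
        ∫ x, c x * (P i x ^ 2 * η x ^ 2) := by
    intro i
    obtain ⟨D, hD⟩ := hψ i
    refine (integral_weak_linearized hf hv hvc hD hηc.mul_left
      (fun x hx => heq x (hηV (hsupp _ hx))) i).trans (integral_congr_ae (.of_forall fun x => ?_))
    simp only [hc_def, hP_def]
    ring
  have hHi : ∀ i j, Integrable fun x => H i j x *
      lineDeriv ℝ (fun x => P i x * η x * η x) x (stdBasis n j) := by
    intro i j
    obtain ⟨D, hD⟩ := hψ i
    exact hD.integrable_mul_lineDeriv hηc.mul_left _ (hH i j)
  have hTi : Integrable fun x => ∑ i, ∑ j, H i j x *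
      lineDeriv ℝ (fun x => P i x * η x * η x) x (stdBasis n j) :=
    integrable_finsetSum _ fun i _ => integrable_finsetSum _ fun j _ => hHi i j
  have hη2c : ∀ g : Euc n → ℝ, HasCompactSupport fun x => g x * η x ^ 2 := fun g => by
    have h : HasCompactSupport fun x => g x * η x * η x := hηc.mul_left
    simpa only [pow_two, ← mul_assoc] using h
  have hT : ∫ x, ∑ i, ∑ j, H i j x *
      lineDeriv ℝ (fun x => P i x * η x * η x) x (stdBasis n j) =
        ∫ x, c x * (w x * η x ^ 2) := by
    rw [integral_finsetSum _ fun i _ => integrable_finsetSum _ fun j _ => hHi i j]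
    simp only [hweak]
    have hPi : ∀ i, Integrable fun x => c x * (P i x ^ 2 * η x ^ 2) := fun i =>
      hci (fun x => P i x ^ 2 * η x ^ 2) (((hP i).continuous.pow 2).mul (hη.continuous.pow 2))
        (hη2c _)
    rw [← integral_finsetSum _ fun i _ => hPi i]
    simp only [hw_def, Finset.sum_mul, Finset.mul_sum]
  have hgrad : ∫ x, ‖gradient v x‖ ^ 2 * ‖gradient η x‖ ^ 2 =
      ∫ x, w x * ∑ j, dη j x ^ 2 := by
    refine integral_congr_ae ?_
    filter_upwards [hη.ae_differentiableAt] with x hx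
    simp only [norm_gradient_sq, hdη_def, hx.lineDeriv_eq_fderiv]
    rfl
  have hdi : ∀ g : Euc n → ℝ, Continuous g → Integrable fun x => g x * ∑ j, dη j x ^ 2 := by
    intro g hg
    simp only [Finset.mul_sum]
    exact integrable_finsetSum _ fun j _ => hη.integrable_mul_lineDeriv_sq hηc _ hg
  have hcη : Integrable fun x => c x * η x ^ 2 := by
    simpa using hci (fun x => 1 * η x ^ 2) (continuous_const.mul (hη.continuous.pow 2)) (hη2c _)
  have hdη : Integrable fun x => ∑ j, dη j x ^ 2 := by
    simpa using hdi (fun _ => 1) continuous_const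
  have main : ∀ δ : ℝ, 0 < δ → ∫ x, Asq v x * η x ^ 2 ≤
      (∫ x, w x * ∑ j, dη j x ^ 2) + δ * ((∫ x, ∑ j, dη j x ^ 2) - ∫ x, c x * η x ^ 2) := by
    intro δ hδ
    have hwδ : ∀ x, 0 < w x + δ := fun x => add_pos_of_nonneg_of_pos (hw0 x) hδ
    set s : Euc n → ℝ := fun x => √(w x + δ) with hs_def
    have hs : ContDiff ℝ 1 s := (hw.add contDiff_const).sqrt fun x => (hwδ x).ne'
    have hs2 : ∀ x, s x ^ 2 = w x + δ := fun x => Real.sq_sqrt (hwδ x).le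
    have hs0 : ∀ x, 0 < s x := fun x => Real.sqrt_pos.2 (hwδ x)
    obtain ⟨D, hD⟩ : ∃ D, LipschitzWith D fun x => s x * η x := by
      have h1 : HasCompactSupport fun x => s x - √δ :=
        hwc.comp_left (g := fun t => √(t + δ) - √δ) (by simp)
      obtain ⟨A, hA⟩ := ContDiff.lipschitzWith_of_hasCompactSupport h1
        (hs.sub contDiff_const) (by simp)
      obtain ⟨M, hM⟩ := h1.exists_bound_of_continuous (hs.sub contDiff_const).continuous
      have hsA : LipschitzWith A s := by
        refine LipschitzWith.of_dist_le_mul fun x y => ?_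
        simpa [dist_sub_right] using hA.dist_le_mul x y
      refine hsA.exists_lipschitzWith_mul hη (M := M + √δ) (fun x => ?_) hMη
      have := (abs_le.1 (hM x)).2
      rw [abs_of_pos (hs0 x)]
      linarith
    have hst := stability_of_lipschitzWith hcm hcL hV hstab hD hηc.mul_left
      ((hsupp s).trans hηV)
    have hξi : Integrable fun x =>
        ∑ j, lineDeriv ℝ (fun x => s x * η x) x (stdBasis n j) ^ 2 :=
      integrable_finsetSum _ fun j _ => by
        simpa using hD.integrable_mul_lineDeriv_sq (μ := volume) hηc.mul_left (stdBasis n j)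
          (continuous_const (y := (1 : ℝ)))
    have hptwise : ∀ᵐ x, Asq v x * η x ^ 2 ≤
        (∑ i, ∑ j, H i j x * lineDeriv ℝ (fun x => P i x * η x * η x) x (stdBasis n j)) -
          (∑ j, lineDeriv ℝ (fun x => s x * η x) x (stdBasis n j) ^ 2) +
          (w x + δ) * ∑ j, dη j x ^ 2 := by
      filter_upwards [ae_all_iff.2 fun j => hη.ae_lineDifferentiableAt (μ := volume)
        (stdBasis n j)] with x hx
      have hηline : ∀ j, HasDerivAt (fun t : ℝ => η (x + t • stdBasis n j)) (dη j x) 0 :=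
        fun j => (hx j).hasLineDerivAt
      have e1 : ∀ i j, lineDeriv ℝ (fun x => P i x * η x * η x) x (stdBasis n j) =
          H i j x * η x ^ 2 + 2 * P i x * η x * dη j x := by
        intro i j
        refine (((hPline i j x).mul (hηline j)).mul (hηline j)).deriv.trans ?_
        simp only [zero_smul, add_zero, Pi.mul_apply]
        ring
      have e2 : ∀ j, lineDeriv ℝ (fun x => s x * η x) x (stdBasis n j) =
          (∑ i, P i x * H i j x) / s x * η x + s x * dη j x := by
        intro j
        have hwl : HasDerivAt (fun t : ℝ => w (x + t • stdBasis n j) + δ)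
            (2 * ∑ i, P i x * H i j x) 0 := by
          have := HasDerivAt.fun_sum (u := Finset.univ) fun i _ => (hPline i j x).pow 2
          refine (this.add_const δ).congr_deriv ?_
          simp [Finset.mul_sum, mul_assoc]
        have hsl := hwl.sqrt (by simpa using (hwδ x).ne')
        refine (hsl.mul (hηline j)).deriv.trans ?_
        simp only [zero_smul, add_zero]
        change 2 * _ / (2 * s x) * _ + s x * _ = _
        rw [mul_div_mul_left _ _ two_ne_zero]
      simp only [e1, e2]
      have hA := mul_le_mul_of_nonneg_right (Asq_le hv x hδ) (sq_nonneg (η x))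
      refine hA.trans (le_of_eq ?_)
      have e3 : ∀ j, ((∑ i, P i x * H i j x) / s x * η x + s x * dη j x) ^ 2 =
          (∑ i, P i x * H i j x) ^ 2 / (w x + δ) * η x ^ 2 +
            2 * η x * ((∑ i, P i x * H i j x) * dη j x) + (w x + δ) * dη j x ^ 2 := by
        intro j
        have := (hs0 x).ne'
        rw [← hs2]
        field_simp
        ring
      have e4 : ∑ i, ∑ j, H i j x * (H i j x * η x ^ 2 + 2 * P i x * η x * dη j x) =
          (∑ i, ∑ j, H i j x ^ 2) * η x ^ 2 +
            2 * η x * ∑ j, (∑ i, P i x * H i j x) * dη j x := by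
        simp only [mul_add, Finset.sum_add_distrib, Finset.sum_mul, Finset.mul_sum]
        congr 1
        · exact Finset.sum_congr rfl fun i _ => Finset.sum_congr rfl fun j _ => by ring
        · rw [Finset.sum_comm]
          exact Finset.sum_congr rfl fun i _ => Finset.sum_congr rfl fun j _ => by ring
      simp only [e3, e4, Finset.sum_add_distrib, ← Finset.mul_sum, ← Finset.sum_mul]
      ring
    have hsη : ∫ x, c x * (s x * η x) ^ 2 =
        (∫ x, c x * (w x * η x ^ 2)) + δ * ∫ x, c x * η x ^ 2 := by
      have hwi : Integrable fun x => c x * (w x * η x ^ 2) :=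
        hci (fun x => w x * η x ^ 2) (hw.continuous.mul (hη.continuous.pow 2)) (hη2c _)
      rw [← integral_const_mul, ← integral_add hwi (hcη.const_mul δ)]
      refine integral_congr_ae (.of_forall fun x => ?_)
      simp only [mul_pow, hs2]
      ring
    have hwη : ∫ x, (w x + δ) * ∑ j, dη j x ^ 2 =
        (∫ x, w x * ∑ j, dη j x ^ 2) + δ * ∫ x, ∑ j, dη j x ^ 2 := by
      rw [← integral_const_mul, ← integral_add (hdi w hw.continuous) (hdη.const_mul δ)]
      simp only [add_mul]
    have hwδi : Integrable fun x => (w x + δ) * ∑ j, dη j x ^ 2 :=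
      hdi (fun x => w x + δ) (hw.continuous.add continuous_const)
    have hle := integral_mono_of_nonneg
      (.of_forall fun x => mul_nonneg (Asq_nonneg hv x) (sq_nonneg (η x)))
      ((hTi.sub hξi).add hwδi) hptwise
    have hsplit := integral_add (hTi.sub hξi) hwδi
    have hsplit' := integral_sub hTi hξi
    simp only [Pi.add_apply, Pi.sub_apply] at hle hsplit hsplit'
    rw [hsplit, hsplit', hT, hwη] at hle
    rw [hsη] at hst
    linarith
  rw [hgrad]
  have hlim : Tendsto (fun δ : ℝ => (∫ x, w x * ∑ j, dη j x ^ 2) +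
      δ * ((∫ x, ∑ j, dη j x ^ 2) - ∫ x, c x * η x ^ 2)) (𝓝[>] 0)
      (𝓝 (∫ x, w x * ∑ j, dη j x ^ 2)) :=
    (Continuous.tendsto' (by fun_prop) _ _ (by simp)).mono_left nhdsWithin_le_nhds
  exact ge_of_tendsto hlim (by filter_upwards [self_mem_nhdsWithin] with δ hδ using main δ hδ)

end GeometricInequality

section Localization

variable {n : ℕ}

theorem Filter.EventuallyEq.gradient_eq_gradient {u v : Euc n → ℝ} {x : Euc n}
    (h : u =ᶠ[𝓝 x] v) : gradient u x = gradient v x := by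
  rw [gradient, gradient, h.fderiv_eq]

theorem Filter.EventuallyEq.Asq_eq_Asq {u v : Euc n → ℝ} {x : Euc n} (h : u =ᶠ[𝓝 x] v) :
    Asq u x = Asq v x := by
  rw [Asq, Asq, h.fderiv_eq, h.gradient_eq_gradient, (h.iteratedFDeriv ℝ 2).eq_of_nhds]

theorem Filter.EventuallyEq.lapl_eq_lapl {u v : Euc n → ℝ} {x : Euc n} (h : u =ᶠ[𝓝 x] v) :
    lapl u x = lapl v x := by
  rw [lapl, lapl, (h.iteratedFDeriv ℝ 2).eq_of_nhds]

theorem gradient_eq_zero_of_notMem_tsupport {η : Euc n → ℝ} {x : Euc n} (hx : x ∉ tsupport η) :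
    gradient η x = 0 := by
  have h : η =ᶠ[𝓝 x] fun _ => 0 := notMem_tsupport_iff_eventuallyEq.1 hx
  rw [gradient_eq_zero_iff_fderiv_eq_zero, h.fderiv_eq, fderiv_const_apply]

theorem exists_contDiff_eq_one_nhdsSet_eq_zero_compl {s t : Set (Euc n)} (hs : IsClosed s)
    (h : s ⊆ interior t) : ∃ χ : Euc n → ℝ, ContDiff ℝ 2 χ ∧ (∀ᶠ x in 𝓝ˢ s, χ x = 1) ∧
      ∀ x ∉ t, χ x = 0 := by
  obtain ⟨χ, h1, h0, -⟩ := exists_contMDiffMap_one_nhds_of_subset_interior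
    (n := 2) (modelWithCornersSelf ℝ (Euc n)) hs h
  exact ⟨χ, contMDiff_iff_contDiff.1 χ.contMDiff, h1, h0⟩

theorem contDiff_mul_of_contDiffOn {χ u : Euc n → ℝ} {S U : Set (Euc n)} (hU : IsOpen U)
    (hS : IsClosed S) (hSU : S ⊆ U) (hu : ContDiffOn ℝ 2 u U) (hχ : ContDiff ℝ 2 χ)
    (h0 : ∀ x ∉ S, χ x = 0) : ContDiff ℝ 2 fun x => χ x * u x := by
  refine contDiff_iff_contDiffAt.2 fun x => ?_
  by_cases hx : x ∈ S
  · exact hχ.contDiffAt.mul (hu.contDiffAt (hU.mem_nhds (hSU hx)))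
  · refine contDiffAt_const (c := (0 : ℝ)) |>.congr_of_eventuallyEq ?_
    filter_upwards [hS.isOpen_compl.mem_nhds hx] with y hy
    rw [h0 y hy, zero_mul]

/-- A locally Lipschitz function agrees with a globally Lipschitz one on any bounded interval. -/
theorem LocallyLipschitz.exists_lipschitzWith_eqOn {f : ℝ → ℝ} (hf : LocallyLipschitz f) (a b : ℝ) :
    ∃ (g : ℝ → ℝ) (L : ℝ≥0), LipschitzWith L g ∧ EqOn f g (Icc a b) := by
  obtain ⟨L, hL⟩ :=
    (hf.locallyLipschitzOn (s := Icc a b)).exists_lipschitzOnWith_of_compact isCompact_Icc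
  obtain ⟨g, hg, hfg⟩ := hL.extend_real
  exact ⟨g, L, hg, hfg⟩

end Localization

/-- Sternberg–Zumbrun-type inequality, Lemma 2.3: for a stable `C²`
solution of `−Δu = f(u)` in `B₁` and any Lipschitz `η` with compact support in `B₁`,
`∫_{B₁} 𝒜² η² dx ≤ ∫_{B₁} |∇u|² |∇η|² dx`, with `𝒜` the curvature-type quantity. -/
theorem stmt9 (n : ℕ) (f : ℝ → ℝ) (u : Euc n → ℝ)
    (hf : LocallyLipschitz f)
    (hu : ContDiffOn ℝ 2 u (ball 0 1))
    (hstable : IsStableIn f u (ball 0 1)) :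
    ∀ (η : Euc n → ℝ) (K : NNReal), LipschitzWith K η → HasCompactSupport η →
      tsupport η ⊆ ball 0 1 →
      (∫ x in ball (0 : Euc n) 1, Asq u x * η x ^ 2) ≤
        ∫ x in ball (0 : Euc n) 1, ‖gradient u x‖ ^ 2 * ‖gradient η x‖ ^ 2 := by
  intro η K hη hηc hηB
  obtain ⟨S, hSc, hηS, hSB⟩ := exists_compact_between hηc isOpen_ball hηB
  obtain ⟨χ, hχ, hχ1, hχ0⟩ :=
    exists_contDiff_eq_one_nhdsSet_eq_zero_compl (isClosed_tsupport η) hηS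
  obtain ⟨V', hV', hηV', hχV'⟩ := eventually_nhdsSet_iff_exists.1 hχ1
  set v : Euc n → ℝ := fun x => χ x * u x with hv_def
  set V : Set (Euc n) := V' ∩ ball 0 1 with hV_def
  have hV : IsOpen V := hV'.inter isOpen_ball
  have hηV : tsupport η ⊆ V := subset_inter hηV' hηB
  have hv : ContDiff ℝ 2 v :=
    contDiff_mul_of_contDiffOn isOpen_ball hSc.isClosed hSB hu hχ hχ0
  have hvc : HasCompactSupport v :=
    HasCompactSupport.intro hSc fun x hx => by simp [hv_def, hχ0 x hx]
  have huv : ∀ x ∈ V, u x = v x := fun x hx => by simp [hv_def, hχV' x hx.1]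
  have hgerm : ∀ x ∈ V, u =ᶠ[𝓝 x] v := fun x hx => by
    filter_upwards [hV.mem_nhds hx] with y hy using huv y hy
  obtain ⟨R, hR⟩ := hvc.exists_bound_of_continuous hv.continuous
  obtain ⟨g, L, hg, hfg⟩ := hf.exists_lipschitzWith_eqOn (-(R + 1)) (R + 1)
  have hmem : ∀ x, v x ∈ Ioo (-(R + 1)) (R + 1) := fun x => by
    have := abs_le.1 (hR x)
    constructor <;> linarith
  have hfgv : ∀ x, lowerDeriv f (v x) = lowerDeriv g (v x) := fun x =>
    lowerDeriv_congr (hfg.eventuallyEq_of_mem (Icc_mem_nhds (hmem x).1 (hmem x).2))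
  have key := integral_Asq_mul_sq_le hg hv hvc hη hηc hV hηV
    (fun x hx => by
      rw [← (hgerm x hx).lapl_eq_lapl, hstable.1 x hx.2, huv x hx,
        hfg (Ioo_subset_Icc_self (hmem x))])
    (fun ξ hξ hξc hξV => by
      have h := hstable.2 ξ hξ hξc (hξV.trans inter_subset_right)
      rw [setIntegral_eq_integral_of_forall_compl_eq_zero fun x hx => by
          rw [image_eq_zero_of_notMem_tsupport fun h => hx (hξV h).2]; ring,
        setIntegral_eq_integral_of_forall_compl_eq_zero fun x hx => by
          rw [gradient_eq_zero_of_notMem_tsupport fun h => hx (hξV h).2]; simp] at h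
      refine le_trans (le_of_eq (integral_congr_ae (.of_forall fun x => ?_))) h
      by_cases hx : x ∈ tsupport ξ
      · simp only [huv x (hξV hx), hfgv]
      · simp [image_eq_zero_of_notMem_tsupport hx])
  rw [setIntegral_eq_integral_of_forall_compl_eq_zero fun x hx => by
      rw [image_eq_zero_of_notMem_tsupport fun h => hx (hηB h)]; ring,
    setIntegral_eq_integral_of_forall_compl_eq_zero fun x hx => by
      rw [gradient_eq_zero_of_notMem_tsupport fun h => hx (hηB h)]; simp]
  convert key using 3 with x x
  · by_cases hx : x ∈ tsupport η
    · rw [(hgerm x (hηV hx)).Asq_eq_Asq]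
    · simp [image_eq_zero_of_notMem_tsupport hx]
  · by_cases hx : x ∈ tsupport η
    · rw [(hgerm x (hηV hx)).gradient_eq_gradient]
    · simp [gradient_eq_zero_of_notMem_tsupport hx]
end
end

section
/- Let {a_j}_{j≥0} and {b_j}_{j≥0} be two sequences of nonnegative real numbers and let M, L be positive constants such that: a₀ ≤ M, b₀ ≤ M; b_j ≤ b_{j−1} and a_j + b_j ≤ L a_{j−1} for all j ≥ 1; and for all j ≥ 1, if a_j ≥ (1/2) a_{j−1} then b_j ≤ L (b_{j−1} − b_j). Then there exist θ ∈ (0,1) and C > 0, depending only on L, such that b_j ≤ C M θ^j for all j ≥ 0. -/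
open MeasureTheory Metric Filter Set
open scoped ENNReal NNReal

noncomputable section

/-- If each step either halves `a` or contracts `b` by a factor `q` with `L q ^ N ≤ 1 / 2`, then
the product `a j * b j ^ N` decays like `2⁻ʲ`. -/
lemma mul_pow_le_half_pow {L q M : ℝ} {N : ℕ} {a b : ℕ → ℝ} (hL : 0 ≤ L)
    (hqN : L * q ^ N ≤ 1 / 2) (ha : ∀ j, 0 ≤ a j) (hb : ∀ j, 0 ≤ b j)
    (ha0 : a 0 ≤ M) (hb0 : b 0 ≤ M) (hmono : ∀ j, b (j + 1) ≤ b j)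
    (hgrow : ∀ j, a (j + 1) ≤ L * a j)
    (hstep : ∀ j, (1 / 2) * a j ≤ a (j + 1) → b (j + 1) ≤ q * b j) (j : ℕ) :
    a j * b j ^ N ≤ M ^ (N + 1) * (1 / 2) ^ j := by
  induction j with
  | zero =>
    have hM : 0 ≤ M := (ha 0).trans ha0
    calc a 0 * b 0 ^ N ≤ M * M ^ N :=
          mul_le_mul ha0 (pow_le_pow_left₀ (hb 0) hb0 N) (pow_nonneg (hb 0) N) hM
      _ = M ^ (N + 1) * (1 / 2) ^ 0 := by ring
  | succ j ih =>
    have hab : 0 ≤ a j * b j ^ N := mul_nonneg (ha j) (pow_nonneg (hb j) N)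
    have hhalf : a (j + 1) * b (j + 1) ^ N ≤ 1 / 2 * (a j * b j ^ N) := by
      rcases le_total ((1 / 2) * a j) (a (j + 1)) with h | h
      · calc a (j + 1) * b (j + 1) ^ N ≤ (L * a j) * (q * b j) ^ N :=
              mul_le_mul (hgrow j) (pow_le_pow_left₀ (hb _) (hstep j h) N)
                (pow_nonneg (hb _) N) (mul_nonneg hL (ha j))
          _ = L * q ^ N * (a j * b j ^ N) := by ring
          _ ≤ 1 / 2 * (a j * b j ^ N) := mul_le_mul_of_nonneg_right hqN hab
      · calc a (j + 1) * b (j + 1) ^ N ≤ (1 / 2 * a j) * b j ^ N :=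
              mul_le_mul h (pow_le_pow_left₀ (hb _) (hmono j) N)
                (pow_nonneg (hb _) N) (mul_nonneg (by norm_num) (ha j))
          _ = 1 / 2 * (a j * b j ^ N) := by ring
    calc a (j + 1) * b (j + 1) ^ N ≤ 1 / 2 * (M ^ (N + 1) * (1 / 2) ^ j) := by linarith
      _ = M ^ (N + 1) * (1 / 2) ^ (j + 1) := by ring

/-- iteration lemma, Lemma 3.2: if `a_j, b_j ≥ 0` satisfy `a₀, b₀ ≤ M`,
`b_j ≤ b_{j−1}`, `a_j + b_j ≤ L a_{j−1}`, and `a_j ≥ a_{j−1}/2 → b_j ≤ L(b_{j−1} − b_j)`,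
then `b_j ≤ C M θʲ` for some `θ ∈ (0,1)` and `C > 0` depending only on `L`. -/
theorem stmt13 (L : ℝ) (hL : 0 < L) :
    ∃ θ C : ℝ, 0 < θ ∧ θ < 1 ∧ 0 < C ∧
      ∀ (a b : ℕ → ℝ) (M : ℝ), 0 < M →
        (∀ j, 0 ≤ a j) → (∀ j, 0 ≤ b j) →
        a 0 ≤ M → b 0 ≤ M →
        (∀ j : ℕ, b (j + 1) ≤ b j) →
        (∀ j : ℕ, a (j + 1) + b (j + 1) ≤ L * a j) →
        (∀ j : ℕ, (1 / 2) * a j ≤ a (j + 1) → b (j + 1) ≤ L * (b j - b (j + 1))) →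
        ∀ j : ℕ, b j ≤ C * M * θ ^ j := by
  set q : ℝ := L / (1 + L) with hq_def
  have hq1 : q < 1 := by rw [hq_def, div_lt_one (by positivity)]; linarith
  obtain ⟨N, hN⟩ := exists_pow_lt_of_lt_one (show 0 < 1 / (2 * L) by positivity) hq1
  have hqN : L * q ^ N ≤ 1 / 2 := by
    calc L * q ^ N ≤ L * (1 / (2 * L)) := mul_le_mul_of_nonneg_left hN.le hL.le
      _ = 1 / 2 := by field_simp
  set θ : ℝ := (1 / 2 : ℝ) ^ (((N + 1 : ℕ) : ℝ)⁻¹) with hθ_def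
  have hθ0 : 0 < θ := by positivity
  have hθ1 : θ < 1 := Real.rpow_lt_one (by norm_num) (by norm_num) (by positivity)
  have hθN : θ ^ (N + 1) = 1 / 2 := Real.rpow_inv_natCast_pow (by norm_num) N.succ_ne_zero
  refine ⟨θ, 2 * L + 1, hθ0, hθ1, by positivity, ?_⟩
  intro a b M hM ha hb ha0 hb0 hmono hsum hcond j
  have hstep : ∀ j, (1 / 2) * a j ≤ a (j + 1) → b (j + 1) ≤ q * b j := by
    intro j h
    have := hcond j h
    rw [hq_def, div_mul_eq_mul_div, le_div_iff₀ (by positivity)]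
    linarith
  cases j with
  | zero => nlinarith [mul_pos hL hM]
  | succ j =>
    have hdecay := mul_pow_le_half_pow hL.le hqN ha hb ha0 hb0 hmono
      (fun j => by linarith [hsum j, hb (j + 1)]) hstep j
    have hC : 2 * L ≤ (2 * L + 1) ^ (N + 1) :=
      (by linarith : 2 * L ≤ 2 * L + 1).trans
        (le_self_pow₀ (by linarith) N.succ_ne_zero)
    rw [← pow_le_pow_iff_left₀ (hb _) (by positivity) N.succ_ne_zero]
    calc b (j + 1) ^ (N + 1) = b (j + 1) * b (j + 1) ^ N := by ring
      _ ≤ (L * a j) * b j ^ N :=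
          mul_le_mul (by linarith [hsum j, ha (j + 1)])
            (pow_le_pow_left₀ (hb _) (hmono j) N) (pow_nonneg (hb _) N)
            (mul_nonneg hL.le (ha j))
      _ = L * (a j * b j ^ N) := by ring
      _ ≤ L * (M ^ (N + 1) * (1 / 2) ^ j) := mul_le_mul_of_nonneg_left hdecay hL.le
      _ = 2 * L * (M ^ (N + 1) * (1 / 2) ^ (j + 1)) := by ring
      _ ≤ (2 * L + 1) ^ (N + 1) * (M ^ (N + 1) * (1 / 2) ^ (j + 1)) :=
          mul_le_mul_of_nonneg_right hC (by positivity)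
      _ = ((2 * L + 1) * M * θ ^ (j + 1)) ^ (N + 1) := by
          rw [mul_pow, mul_pow, ← pow_mul, mul_comm (j + 1) (N + 1), pow_mul, hθN, mul_assoc]
end
end

section
/- Let n ≥ 1, β ∈ ℝ, and C₀ > 0. Let σ be a function from the class of open balls in ℝⁿ to [0, +∞] such that whenever an open ball B is covered by finitely many open balls B₁, …, B_N one has σ(B) ≤ Σ_{j=1}^N σ(B_j), and such that σ(B₁(0)) < ∞, where B₁(0) is the unit ball. Then there exists δ > 0, depending only on n and β, with the following property: if r^β σ(B_{r/4}(y)) ≤ δ r^β σ(B_r(y)) + C₀ whenever the ball B_r(y) is contained in B₁(0), then σ(B_{1/2}(0)) ≤ C C₀, where C depends only on n and β. -/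
open MeasureTheory Metric Filter Set
open scoped ENNReal NNReal

noncomputable section

/-- The closed half ball is covered by finitely many balls of radius `1/16` centered in it. -/
theorem exists_fin_cover_closedBall_half (n : ℕ) :
    ∃ (N : ℕ) (w : Fin N → Euc n), (∀ j, ‖w j‖ ≤ 1 / 2) ∧
      closedBall (0 : Euc n) (1 / 2) ⊆ ⋃ j, ball (w j) (1 / 16) := by
  obtain ⟨t, hts, hfin, hcov⟩ := finite_cover_balls_of_compact
    (isCompact_closedBall (0 : Euc n) (1 / 2)) (show (0 : ℝ) < 1 / 16 by norm_num)
  obtain ⟨N, w, -, hw⟩ := hfin.fin_param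
  subst hw
  refine ⟨N, w, fun j => ?_, fun x hx => ?_⟩
  · simpa using hts (mem_range_self j)
  · simpa using hcov hx

/-- Rescaling a covering of the half ball to a covering of `ball y (r / 2)`. -/
theorem ball_half_subset_iUnion_ball {n N : ℕ} {w : Fin N → Euc n}
    (hcov : closedBall (0 : Euc n) (1 / 2) ⊆ ⋃ j, ball (w j) (1 / 16))
    (y : Euc n) {r : ℝ} (hr : 0 < r) :
    ball y (r / 2) ⊆ ⋃ j, ball (y + r • w j) (r / 16) := by
  intro x hx
  have hmem : r⁻¹ • (x - y) ∈ closedBall (0 : Euc n) (1 / 2) := by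
    rw [mem_ball, dist_eq_norm] at hx
    rw [mem_closedBall_zero_iff, norm_smul, Real.norm_of_nonneg (inv_nonneg.2 hr.le),
      inv_mul_le_iff₀ hr]
    linarith
  obtain ⟨j, hj⟩ := mem_iUnion.1 (hcov hmem)
  refine mem_iUnion.2 ⟨j, ?_⟩
  rw [mem_ball, dist_eq_norm] at hj ⊢
  have hx' : x - (y + r • w j) = r • (r⁻¹ • (x - y) - w j) := by
    rw [smul_sub, smul_inv_smul₀ hr.ne']
    abel
  rw [hx', norm_smul, Real.norm_of_nonneg hr.le]
  nlinarith

/-- A finite quantity which is at most half of itself plus `a` is at most `2 * a`. -/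
theorem ENNReal.le_two_mul_of_le_mul_add {K C₀ : ℝ} (hK : 0 < K) (hC₀ : 0 < C₀) {Q : ℝ≥0∞}
    (hQ : Q ≠ ⊤)
    (h : Q ≤ ENNReal.ofReal K * (ENNReal.ofReal (1 / (2 * K)) * Q + ENNReal.ofReal C₀)) :
    Q ≤ ENNReal.ofReal (2 * K * C₀) := by
  lift Q to ℝ≥0 using hQ
  have hδ : 0 < 1 / (2 * K) := by positivity
  rw [← ENNReal.ofReal_coe_nnreal, ← ENNReal.ofReal_mul hδ.le,
    ← ENNReal.ofReal_add (by positivity) hC₀.le, ← ENNReal.ofReal_mul hK.le,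
    ENNReal.ofReal_le_ofReal_iff (by positivity)] at h
  rw [← ENNReal.ofReal_coe_nnreal]
  apply ENNReal.ofReal_le_ofReal
  have : K * (1 / (2 * K) * (Q : ℝ) + C₀) = Q / 2 + K * C₀ := by field_simp
  linarith

/-- Simon's covering lemma for a nonnegative exponent, with only radii at most `1` tested. -/
theorem exists_covering_bound_of_nonneg (n : ℕ) {γ : ℝ} (hγ : 0 ≤ γ) :
    ∃ δ C : ℝ, 0 < δ ∧ 0 < C ∧
      ∀ (C₀ : ℝ), 0 < C₀ →
        ∀ σ : Set (Euc n) → ℝ≥0∞,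
          (∀ (c : Euc n) (r : ℝ) (N : ℕ) (y : Fin N → Euc n) (ρ : Fin N → ℝ),
              ball c r ⊆ ⋃ j, ball (y j) (ρ j) →
              σ (ball c r) ≤ ∑ j, σ (ball (y j) (ρ j))) →
          σ (ball 0 1) ≠ ⊤ →
          (∀ (y : Euc n) (r : ℝ), 0 < r → r ≤ 1 → ball y r ⊆ ball 0 1 →
              ENNReal.ofReal (r ^ γ) * σ (ball y (r / 4)) ≤
                ENNReal.ofReal δ * (ENNReal.ofReal (r ^ γ) * σ (ball y r)) +
                  ENNReal.ofReal C₀) →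
          σ (ball 0 (1/2)) ≤ ENNReal.ofReal (C * C₀) := by
  obtain ⟨N, w, hw, hcov⟩ := exists_fin_cover_closedBall_half n
  set K : ℝ := (N + 1) * 4 ^ γ with hKdef
  have hK : 0 < K := by positivity
  refine ⟨1 / (2 * K), 2 * K, by positivity, by positivity, fun C₀ hC₀ σ hsub hfin hdec => ?_⟩
  have hmono : ∀ (c : Euc n) (r : ℝ), ball c r ⊆ ball 0 1 → σ (ball c r) ≤ σ (ball 0 1) := by
    intro c r h
    simpa using hsub c r 1 (fun _ => 0) (fun _ => 1)
      (fun x hx => mem_iUnion.2 ⟨0, h hx⟩)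
  let Q : ℝ≥0∞ := ⨆ (y : Euc n) (r : ℝ) (_ : 0 < r ∧ r ≤ 1 ∧ ball y r ⊆ ball 0 1),
    ENNReal.ofReal (r ^ γ) * σ (ball y (r / 2))
  have le_Q : ∀ (y : Euc n) (r : ℝ), 0 < r → r ≤ 1 → ball y r ⊆ ball 0 1 →
      ENNReal.ofReal (r ^ γ) * σ (ball y (r / 2)) ≤ Q := fun y r h0 h1 hB =>
    le_iSup_of_le y (le_iSup_of_le r (le_iSup_of_le ⟨h0, h1, hB⟩ le_rfl))
  have hQfin : Q ≠ ⊤ := by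
    refine ne_top_of_le_ne_top hfin (iSup_le fun y => iSup_le fun r => iSup_le ?_)
    rintro ⟨h0, h1, hB⟩
    calc ENNReal.ofReal (r ^ γ) * σ (ball y (r / 2))
        ≤ 1 * σ (ball 0 1) := by
          gcongr
          · exact ENNReal.ofReal_le_one.2 (Real.rpow_le_one h0.le h1 hγ)
          · exact hmono _ _ ((ball_subset_ball (by linarith)).trans hB)
      _ = σ (ball 0 1) := one_mul _
  have hQ : Q ≤ ENNReal.ofReal K *
      (ENNReal.ofReal (1 / (2 * K)) * Q + ENNReal.ofReal C₀) := by
    refine iSup_le fun y => iSup_le fun r => iSup_le ?_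
    rintro ⟨h0, h1, hB⟩
    have hsmall : ∀ j, ENNReal.ofReal (r ^ γ) * σ (ball (y + r • w j) (r / 16)) ≤
        ENNReal.ofReal (4 ^ γ) *
          (ENNReal.ofReal (1 / (2 * K)) * Q + ENNReal.ofReal C₀) := by
      intro j
      have hhalf : ball (y + r • w j) (r / 2) ⊆ ball 0 1 := by
        refine (ball_subset_ball' ?_).trans hB
        rw [dist_eq_norm, add_sub_cancel_left, norm_smul, Real.norm_of_nonneg h0.le]
        nlinarith [hw j]
      have hd := hdec (y + r • w j) (r / 4) (by linarith) (by linarith)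
        ((ball_subset_ball (by linarith)).trans hhalf)
      have hq := le_Q (y + r • w j) (r / 2) (by linarith) (by linarith) hhalf
      rw [show r / 4 / 4 = r / 16 by ring] at hd
      rw [show r / 2 / 2 = r / 4 by ring] at hq
      have hscale : r ^ γ = 4 ^ γ * (r / 4) ^ γ := by
        rw [← Real.mul_rpow (by norm_num) (by linarith)]
        congr 1
        ring
      rw [hscale, ENNReal.ofReal_mul (by positivity), mul_assoc]
      gcongr
      refine hd.trans ?_
      gcongr
      refine le_trans ?_ hq
      gcongr
      norm_num
    calc ENNReal.ofReal (r ^ γ) * σ (ball y (r / 2))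
        ≤ ENNReal.ofReal (r ^ γ) * ∑ j, σ (ball (y + r • w j) (r / 16)) := by
          gcongr
          exact hsub _ _ _ _ _ (ball_half_subset_iUnion_ball hcov y h0)
      _ ≤ ∑ _j : Fin N, ENNReal.ofReal (4 ^ γ) *
            (ENNReal.ofReal (1 / (2 * K)) * Q + ENNReal.ofReal C₀) := by
          rw [Finset.mul_sum]
          exact Finset.sum_le_sum fun j _ => hsmall j
      _ = ENNReal.ofReal (N * 4 ^ γ) *
            (ENNReal.ofReal (1 / (2 * K)) * Q + ENNReal.ofReal C₀) := by
          rw [Finset.sum_const, Finset.card_univ, Fintype.card_fin, nsmul_eq_mul,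
            ENNReal.ofReal_mul (by positivity), ENNReal.ofReal_natCast, mul_assoc]
      _ ≤ _ := by
          gcongr
          rw [hKdef]
          gcongr
          linarith
  have hhalf := le_Q 0 1 one_pos le_rfl subset_rfl
  rw [Real.one_rpow, ENNReal.ofReal_one, one_mul] at hhalf
  exact hhalf.trans (ENNReal.le_two_mul_of_le_mul_add hK hC₀ hQfin hQ)

/-- abstract covering lemma, Lemma A.4, due to Simon: if `σ` is a
finitely subadditive set function on balls with `σ(B₁) < ∞`, and
`r^β σ(B_{r/4}(y)) ≤ δ r^β σ(B_r(y)) + C₀` whenever `B_r(y) ⊆ B₁`, with `δ = δ(n,β)` small,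
then `σ(B_{1/2}) ≤ C C₀` with `C = C(n,β)`. -/
theorem stmt19 (n : ℕ) (β : ℝ) :
    ∃ δ C : ℝ, 0 < δ ∧ 0 < C ∧
      ∀ (C₀ : ℝ), 0 < C₀ →
        ∀ σ : Set (Euc n) → ℝ≥0∞,
          (∀ (c : Euc n) (r : ℝ) (N : ℕ) (y : Fin N → Euc n) (ρ : Fin N → ℝ),
              ball c r ⊆ ⋃ j, ball (y j) (ρ j) →
              σ (ball c r) ≤ ∑ j, σ (ball (y j) (ρ j))) →
          σ (ball 0 1) ≠ ⊤ →
          (∀ (y : Euc n) (r : ℝ), 0 < r → ball y r ⊆ ball 0 1 →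
              ENNReal.ofReal (r ^ β) * σ (ball y (r / 4)) ≤
                ENNReal.ofReal δ * (ENNReal.ofReal (r ^ β) * σ (ball y r)) +
                  ENNReal.ofReal C₀) →
          σ (ball 0 (1/2)) ≤ ENNReal.ofReal (C * C₀) := by
  obtain ⟨δ, C, hδ, hC, H⟩ := exists_covering_bound_of_nonneg n (le_max_right β 0)
  refine ⟨δ, C, hδ, hC, fun C₀ hC₀ σ hsub hfin hdec => H C₀ hC₀ σ hsub hfin ?_⟩
  intro y r h0 h1 hB
  have h := hdec y r h0 hB
  rcases le_total 0 β with hβ | hβ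
  · rwa [max_eq_left hβ]
  · have hinv : ENNReal.ofReal (r ^ (-β)) * ENNReal.ofReal (r ^ β) = 1 := by
      rw [← ENNReal.ofReal_mul (by positivity), ← Real.rpow_add h0, neg_add_cancel,
        Real.rpow_zero, ENNReal.ofReal_one]
    rw [max_eq_right hβ, Real.rpow_zero, ENNReal.ofReal_one, one_mul, one_mul]
    calc σ (ball y (r / 4))
        = ENNReal.ofReal (r ^ (-β)) * (ENNReal.ofReal (r ^ β) * σ (ball y (r / 4))) := by
          rw [← mul_assoc, hinv, one_mul]
      _ ≤ ENNReal.ofReal (r ^ (-β)) *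
            (ENNReal.ofReal δ * (ENNReal.ofReal (r ^ β) * σ (ball y r)) +
              ENNReal.ofReal C₀) := by gcongr
      _ = ENNReal.ofReal (r ^ (-β)) * ENNReal.ofReal (r ^ β) *
              (ENNReal.ofReal δ * σ (ball y r)) +
            ENNReal.ofReal (r ^ (-β)) * ENNReal.ofReal C₀ := by ring
      _ ≤ 1 * (ENNReal.ofReal δ * σ (ball y r)) + 1 * ENNReal.ofReal C₀ := by
          rw [hinv]
          gcongr
          exact ENNReal.ofReal_le_one.2 (Real.rpow_le_one h0.le h1 (by linarith))
      _ = ENNReal.ofReal δ * σ (ball y r) + ENNReal.ofReal C₀ := by rw [one_mul, one_mul]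
end
end
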